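/- arXiv:2101.11194 — 3 statements merged into one kernel-verified Lean document; each statement's English description precedes it below -/
import Mathlib

section
/- Let (𝔄,𝔅) be an access structure on [n], q a prime power, and consider the linear NSS protocol over F_q with parameters (x,y,z) given by a matrix G∈F_q^{z×(x+y)} and a position map τ:[z]→[n]. If this protocol is an (𝔄,𝔅,n)-CSNSS protocol (complete correctness and complete secrecy), then the pair (G,τ) is an (𝔄,𝔅,n)-MMSP. -/
open scoped Classical BigOperators

/-- A probability mass function on a finite sample space. -/
def IsPMF {Ω : Type*} [Fintype Ω] (p : Ω → ℝ) : Prop :=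
  (∀ ω, 0 ≤ p ω) ∧ ∑ ω, p ω = 1

/-- The uniform probability mass function. -/
noncomputable def uniformPMF (Ω : Type*) [Fintype Ω] : Ω → ℝ :=
  fun _ => (Fintype.card Ω : ℝ)⁻¹

/-- Distribution of the random variable `X` under the mass function `p`. -/
noncomputable def distOf {Ω α : Type*} [Fintype Ω] (p : Ω → ℝ) (X : Ω → α) (a : α) : ℝ :=
  ∑ ω, if X ω = a then p ω else 0

/-- Probability of the event `E` under the mass function `p`. -/
noncomputable def prEvent {Ω : Type*} [Fintype Ω] (p : Ω → ℝ) (E : Ω → Prop) : ℝ :=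
  ∑ ω, if E ω then p ω else 0

/-- Conditional probability mass function given the event `E`. -/
noncomputable def condPMF {Ω : Type*} [Fintype Ω] (p : Ω → ℝ) (E : Ω → Prop) : Ω → ℝ :=
  fun ω => if E ω then p ω / prEvent p E else 0

/-- Conditional probability of `A` given the event `E`. -/
noncomputable def condProb {Ω : Type*} [Fintype Ω] (p : Ω → ℝ) (A E : Ω → Prop) : ℝ :=
  prEvent p (fun ω => A ω ∧ E ω) / prEvent p E

/-- Shannon entropy (natural logarithm) of the random variable `X` under `p`. -/
noncomputable def entropy {Ω α : Type*} [Fintype Ω] [Fintype α]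
    (p : Ω → ℝ) (X : Ω → α) : ℝ :=
  -∑ a, distOf p X a * Real.log (distOf p X a)

/-- Shannon mutual information `I(X;Y)` (natural logarithm) under `p`. -/
noncomputable def mutualInfo {Ω α β : Type*} [Fintype Ω] [Fintype α] [Fintype β]
    (p : Ω → ℝ) (X : Ω → α) (Y : Ω → β) : ℝ :=
  entropy p X + entropy p Y - entropy p (fun ω => (X ω, Y ω))

/-- Conditional mutual information `I(X;Y∣Z)` (natural logarithm) under `p`. -/
noncomputable def condMutualInfo {Ω α β γ : Type*} [Fintype Ω] [Fintype α] [Fintype β]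
    [Fintype γ] (p : Ω → ℝ) (X : Ω → α) (Y : Ω → β) (Z : Ω → γ) : ℝ :=
  entropy p (fun ω => (X ω, Z ω)) + entropy p (fun ω => (Y ω, Z ω))
    - entropy p (fun ω => (X ω, Y ω, Z ω)) - entropy p Z

/-- Independence of the random variables `X` and `Y` under `p`. -/
def IndepRV {Ω α β : Type*} [Fintype Ω] (p : Ω → ℝ) (X : Ω → α) (Y : Ω → β) : Prop :=
  ∀ a b, distOf p (fun ω => (X ω, Y ω)) (a, b) = distOf p X a * distOf p Y b

/-- The binary entropy function `h₂(p) = −p log p − (1−p) log(1−p)`. -/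
noncomputable def binEnt (t : ℝ) : ℝ :=
  -t * Real.log t - (1 - t) * Real.log (1 - t)

/-!
STATEMENT 8: If the linear NSS protocol over `F_q` given by `G ∈ F_q^{z×(x+y)}` and the
position map `τ : [z] → [n]` is an `(𝔄,𝔅,n)`-CSNSS protocol (complete correctness and
complete secrecy), then the pair `(G, τ)` is an `(𝔄,𝔅,n)`-MMSP.
-/

theorem distOf_uniformPMF_self_pos {Ω α : Type*} [Fintype Ω] (X : Ω → α) (ω : Ω) :
    0 < distOf (uniformPMF Ω) X (X ω) := by
  have hcard : (0 : ℝ) < (Fintype.card Ω : ℝ)⁻¹ := by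
    have : 0 < Fintype.card Ω := Fintype.card_pos_iff.mpr ⟨ω⟩
    positivity
  unfold distOf uniformPMF
  refine Finset.sum_pos' (fun ω' _ => ?_) ⟨ω, Finset.mem_univ ω, by simpa using hcard⟩
  split_ifs
  exacts [hcard.le, le_rfl]

/-- Independent random variables on a uniform space attain every pair of attained values. -/
theorem IndepRV.exists_eq_and_eq {Ω α β : Type*} [Fintype Ω] {X : Ω → α} {Y : Ω → β}
    (h : IndepRV (uniformPMF Ω) X Y) (ω₁ ω₂ : Ω) : ∃ ω, X ω = X ω₁ ∧ Y ω = Y ω₂ := by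
  by_contra! hne
  have hpos := mul_pos (distOf_uniformPMF_self_pos X ω₁) (distOf_uniformPMF_self_pos Y ω₂)
  rw [← h] at hpos
  refine hpos.ne' (Finset.sum_eq_zero fun ω _ => if_neg fun hω => ?_)
  exact hne ω (Prod.ext_iff.mp hω).1 (Prod.ext_iff.mp hω).2

theorem dotProduct_eq_zero_of_mem_span {R m : Type*} [CommSemiring R] [Fintype m]
    {s : Set (m → R)} {u v : m → R} (hs : ∀ r ∈ s, r ⬝ᵥ v = 0)
    (hu : u ∈ Submodule.span R s) : u ⬝ᵥ v = 0 := by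
  induction hu using Submodule.span_induction with
  | mem r hr => exact hs r hr
  | zero => exact zero_dotProduct v
  | add a b _ _ ha hb => rw [add_dotProduct, ha, hb, add_zero]
  | smul c a _ ha => rw [smul_dotProduct, ha, smul_zero]

theorem exists_dotProduct_ne_zero_of_notMem {K m : Type*} [Field K] [Fintype m]
    {p : Submodule K (m → K)} {u : m → K} (hu : u ∉ p) :
    ∃ v : m → K, u ⬝ᵥ v ≠ 0 ∧ ∀ r ∈ p, r ⬝ᵥ v = 0 := by
  obtain ⟨f, hfu, hp⟩ := Submodule.exists_le_ker_of_notMem hu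
  have hf : ∀ r, r ⬝ᵥ (fun i => f (Pi.single i 1)) = f r := fun r => by
    rw [LinearMap.pi_apply_eq_sum_univ f r]
    simp only [dotProduct, smul_eq_mul]
    refine Finset.sum_congr rfl fun i _ => ?_
    congr 2
    ext j
    simp [Pi.single_apply, eq_comm]
  exact ⟨fun i => f (Pi.single i 1), by rwa [hf], fun r hr => by rw [hf]; exact hp hr⟩

theorem Fin.append_zero_zero_eq_zero {R : Type*} [Zero R] (x y : ℕ) :
    (Fin.append 0 0 : Fin (x + y) → R) = 0 := by
  ext j
  refine Fin.addCases (fun k => ?_) (fun k => ?_) j <;> simp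

theorem spir_linear_csnss_implies_mmsp
    (F : Type*) [Field F] [Fintype F]
    (n x y z : ℕ)
    (𝔄 𝔅 : Set (Finset (Fin n)))
    -- `(𝔄,𝔅)` is an access structure:
    (hAmono : ∀ A ∈ 𝔄, ∀ C : Finset (Fin n), A ⊆ C → C ∈ 𝔄)
    (hBmono : ∀ B ∈ 𝔅, ∀ C : Finset (Fin n), C ⊆ B → C ∈ 𝔅)
    (hABdisj : 𝔄 ∩ 𝔅 = ∅)
    (G : Matrix (Fin z) (Fin (x + y)) F)
    (τ : Fin z → Fin n)
    -- complete correctness: for every `A ∈ 𝔄` the secret is recovered from `S_A` surely: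
    (hcorrect : ∀ A ∈ 𝔄, ∃ ψ : ({i // τ i ∈ A} → F) → (Fin x → F),
      ∀ (l : Fin x → F) (w : Fin y → F),
        ψ (fun i => G.mulVec (Fin.append l w) i.1) = l)
    -- complete secrecy: for every `B ∈ 𝔅`, `S_B` is independent of the secret `L`:
    (hsecret : ∀ B ∈ 𝔅,
      IndepRV (uniformPMF ((Fin x → F) × (Fin y → F)))
        (fun ω => fun i : {i // τ i ∈ B} => G.mulVec (Fin.append ω.1 ω.2) i.1)
        Prod.fst) :
    -- `(G, τ)` accepts `𝔄`:
    (∀ A ∈ 𝔄, ∀ i : Fin x,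
      (Pi.single (Fin.castAdd y i) 1 : Fin (x + y) → F) ∈
        Submodule.span F ((fun j => fun c => G j c) '' {j : Fin z | τ j ∈ A}))
    ∧
    -- `(G, τ)` rejects `𝔅`:
    (∀ B ∈ 𝔅,
      Submodule.span F
          (Set.range fun i : Fin x =>
            (Pi.single (Fin.castAdd y i) 1 : Fin (x + y) → F))
        ⊓ Submodule.span F ((fun j => fun c => G j c) '' {j : Fin z | τ j ∈ B}) = ⊥) := by
  refine ⟨fun A hA i => ?_, fun B hB => ?_⟩
  · by_contra hi
    obtain ⟨v, hiv, hv⟩ := exists_dotProduct_ne_zero_of_notMem hi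
    obtain ⟨ψ, hψ⟩ := hcorrect A hA
    obtain ⟨l, w, rfl⟩ : ∃ l w, v = Fin.append l w :=
      ⟨fun j => v (Fin.castAdd y j), fun j => v (Fin.natAdd x j), Fin.append_castAdd_natAdd.symm⟩
    have hl : l = 0 := by
      rw [← hψ l w, ← hψ 0 0, Fin.append_zero_zero_eq_zero, Matrix.mulVec_zero]
      congr 1
      ext j
      exact hv _ (Submodule.subset_span ⟨j.1, j.2, rfl⟩)
    simp [hl] at hiv
  · rw [Submodule.eq_bot_iff]
    rintro v ⟨hvE, hvB⟩
    have hnat : ∀ k : Fin y, v (Fin.natAdd x k) = 0 := fun k => by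
      rw [← dotProduct_single_one v]
      refine dotProduct_eq_zero_of_mem_span ?_ hvE
      rintro _ ⟨i, rfl⟩
      simp [Pi.single_apply, Fin.ext_iff]
      omega
    ext j
    refine Fin.addCases (fun i => ?_) hnat j
    obtain ⟨ω, hshares, hsec⟩ := (hsecret B hB).exists_eq_and_eq (0, 0) (Pi.single i 1, 0)
    have hdot : v ⬝ᵥ Fin.append ω.1 ω.2 = 0 := by
      refine dotProduct_eq_zero_of_mem_span ?_ hvB
      rintro _ ⟨k, hk, rfl⟩
      have := congrFun hshares ⟨k, hk⟩
      rwa [Fin.append_zero_zero_eq_zero, Matrix.mulVec_zero] at this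
    simpa [dotProduct, Fin.sum_univ_add, hnat, hsec, Pi.single_apply] using hdot
end

section
/- Let (𝔄,𝔅) be an access structure on [n], q a prime power, and (G,τ) an (𝔄,𝔅,n)-MMSP with G=(G′,G″)∈F_q^{z×x}×F_q^{z×y}. Let f≥2 and for k∈[f] let E_k∈F_q^{x×fx} be the block matrix whose k-th x×x block is the identity I_x and whose other blocks are zero. Let R be uniformly distributed on F_q^{y×fx} and W uniformly distributed on F_q^y, independent. For files M=(M_1,…,M_f)∈F_q^{fx} (each M_i∈F_q^x), define the query matrix Q = G′E_k + G″R ∈ F_q^{z×fx} and the answer vector D = QM + G″W ∈ F_q^z. Then: (i) [correctness] for every A∈𝔄 there exists a matrix K_A∈F_q^{x×|τ⁻¹(A)|} such that K_A·D_{τ⁻¹(A)} = M_k for every value of M, R, W and every k∈[f]; (ii) [server secrecy] for every 𝒳⊆[n], every fixed value ρ of R, every k∈[f], and every pair of file vectors M, M̃ with M_k = M̃_k, the distribution of D_{τ⁻¹(𝒳)} (over uniform W) computed with files M equals the distribution computed with files M̃; (iii) [user secrecy] for every B∈𝔅, the distribution of Q_{τ⁻¹(B)} (over uniform R) is the same for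 all k∈[f]. -/
/-!
STATEMENT 9: From an `(𝔄,𝔅,n)`-MMSP `(G,τ)` with `G = (G′,G″)`, the projected linear SPIR
protocol with queries `Q = G′E_k + G″R` and answers `D = QM + G″W` is an
`(𝔄,𝔅,n,f)`-CSSPIR protocol: (i) complete correctness, (ii) complete server secrecy, and
(iii) complete user secrecy.  Files are `M = (M_1,…,M_f) ∈ F_q^{fx}`, indexed by
`Fin f × Fin x` (the `k`-th block being `M_k`).
-/

/-- The block matrix `E_k ∈ F_q^{x×fx}` whose `k`-th `x×x` block is the identity and whose
other blocks are zero. -/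
def Emat (F : Type*) [Zero F] [One F] (f x : ℕ) (k : Fin f) :
    Matrix (Fin x) (Fin f × Fin x) F :=
  Matrix.of fun i pr => if pr = (k, i) then 1 else 0

/-- A linear map that vanishes on the kernel of `φ` factors through `φ`. -/
lemma LinearMap.exists_comp_eq_of_ker_le_ker {K V V₁ V₂ : Type*} [Field K]
    [AddCommGroup V] [Module K V] [AddCommGroup V₁] [Module K V₁] [AddCommGroup V₂] [Module K V₂]
    (φ : V →ₗ[K] V₁) (ψ : V →ₗ[K] V₂) (h : LinearMap.ker φ ≤ LinearMap.ker ψ) :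
    ∃ g : V₁ →ₗ[K] V₂, g ∘ₗ φ = ψ := by
  obtain ⟨s, hs⟩ := LinearMap.exists_leftInverse_of_injective
    ((LinearMap.ker φ).liftQ φ le_rfl) (Submodule.ker_liftQ_eq_bot _ _ _ le_rfl)
  refine ⟨(LinearMap.ker φ).liftQ ψ h ∘ₗ s, LinearMap.ext fun v => ?_⟩
  have hv := LinearMap.congr_fun hs ((LinearMap.ker φ).mkQ v)
  simp only [LinearMap.comp_apply, Submodule.mkQ_apply, Submodule.liftQ_apply,
    LinearMap.id_apply] at hv
  simp [hv]

/-- If every linear relation between the rows of `S` also holds between the rows of `P`, then `P`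
is a right multiple of `S`. -/
lemma Matrix.exists_eq_mul_of_vecMul_eq_zero {K m a b : Type*} [Field K] [Fintype m] [Fintype b]
    (P : Matrix m a K) (S : Matrix m b K)
    (h : ∀ c : m → K, Matrix.vecMul c S = 0 → Matrix.vecMul c P = 0) :
    ∃ X : Matrix b a K, P = S * X := by
  classical
  obtain ⟨g, hg⟩ := LinearMap.exists_comp_eq_of_ker_le_ker S.vecMulLinear P.vecMulLinear
    fun c hc => by simpa using h c (by simpa using hc)
  refine ⟨Matrix.of fun j => g fun l => if j = l then 1 else 0, ?_⟩
  ext i l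
  have hi := congrFun (LinearMap.congr_fun hg (Pi.single i 1)) l
  simp only [LinearMap.comp_apply, Matrix.vecMulLinear_apply, Matrix.single_one_vecMul] at hi
  refine hi.symm.trans ?_
  rw [LinearMap.pi_apply_eq_sum_univ g]
  simp [Matrix.mul_apply, Finset.sum_apply]

lemma Emat_mulVec {F : Type*} [Semiring F] {f x : ℕ} (k : Fin f) (M : Fin f × Fin x → F) :
    (Emat F f x k).mulVec M = fun i => M (k, i) := by
  ext i
  simp [Emat, Matrix.mulVec, dotProduct]

lemma answer_eq {F : Type*} [CommRing F] {x y z f : ℕ}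
    (G' : Matrix (Fin z) (Fin x) F) (G'' : Matrix (Fin z) (Fin y) F) (k : Fin f)
    (M : Fin f × Fin x → F) (R : Matrix (Fin y) (Fin f × Fin x) F) (W : Fin y → F) :
    (G' * Emat F f x k + G'' * R).mulVec M + G''.mulVec W
      = G'.mulVec (fun i => M (k, i)) + G''.mulVec (R.mulVec M + W) := by
  rw [Matrix.add_mulVec, ← Matrix.mulVec_mulVec, ← Matrix.mulVec_mulVec, Emat_mulVec,
    Matrix.mulVec_add, add_assoc]

/-- A linear combination of the rows of `(G', G'')`, split into its two blocks. -/
lemma sum_smul_append {F : Type*} [Semiring F] {x y : ℕ} {m : Type*} [Fintype m]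
    (P : Matrix m (Fin x) F) (S : Matrix m (Fin y) F) (c : m → F) :
    ∑ j, c j • (Fin.append (fun l => P j l) (fun l => S j l) : Fin (x + y) → F)
      = Fin.append (Matrix.vecMul c P) (Matrix.vecMul c S) := by
  ext l
  refine Fin.addCases (fun l => ?_) (fun l => ?_) l <;>
    simp [Matrix.vecMul, dotProduct, Finset.sum_apply]

lemma mem_span_append_rows_iff {F : Type*} [Field F] {x y z : ℕ}
    (G' : Matrix (Fin z) (Fin x) F) (G'' : Matrix (Fin z) (Fin y) F) (p : Fin z → Prop)
    [DecidablePred p] (v : Fin (x + y) → F) :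
    v ∈ Submodule.span F
        ((fun j => Fin.append (fun c => G' j c) (fun c => G'' j c)) '' {j : Fin z | p j}) ↔
      ∃ c : {j // p j} → F,
        Fin.append (Matrix.vecMul c (G'.submatrix Subtype.val id))
          (Matrix.vecMul c (G''.submatrix Subtype.val id)) = v := by
  rw [Set.image_eq_range]
  refine (Submodule.mem_span_range_iff_exists_fun (α := {j // p j}) F).trans
    (exists_congr fun c => ?_)
  rw [← sum_smul_append]
  rfl

lemma append_zero_mem_span_single {F : Type*} [Field F] {x y : ℕ} (u : Fin x → F) :
    (Fin.append u 0 : Fin (x + y) → F) ∈ Submodule.span F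
      (Set.range fun i : Fin x => (Pi.single (Fin.castAdd y i) 1 : Fin (x + y) → F)) := by
  rw [Submodule.mem_span_range_iff_exists_fun]
  refine ⟨u, ?_⟩
  ext l
  refine Fin.addCases (fun l => ?_) (fun l => ?_) l
  · simp [Finset.sum_apply, Pi.single_apply]
  · have h (i : Fin x) : Fin.natAdd x l ≠ Fin.castAdd y i := by
      simp only [ne_eq, Fin.ext_iff, Fin.val_natAdd, Fin.val_castAdd]
      omega
    simp [Finset.sum_apply, h]

theorem spir_mmsp_implies_csspir
    (F : Type*) [Field F] [Fintype F]
    (n x y z f : ℕ) (hf : 2 ≤ f)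
    (𝔄 𝔅 : Set (Finset (Fin n)))
    -- `(𝔄,𝔅)` is an access structure:
    (hAmono : ∀ A ∈ 𝔄, ∀ C : Finset (Fin n), A ⊆ C → C ∈ 𝔄)
    (hBmono : ∀ B ∈ 𝔅, ∀ C : Finset (Fin n), C ⊆ B → C ∈ 𝔅)
    (hABdisj : 𝔄 ∩ 𝔅 = ∅)
    (G' : Matrix (Fin z) (Fin x) F) (G'' : Matrix (Fin z) (Fin y) F)
    (τ : Fin z → Fin n)
    -- the MMSP `((G′,G″), τ)` accepts `𝔄`:
    (haccept : ∀ A ∈ 𝔄, ∀ i : Fin x,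
      (Pi.single (Fin.castAdd y i) 1 : Fin (x + y) → F) ∈
        Submodule.span F
          ((fun j => Fin.append (fun c => G' j c) (fun c => G'' j c)) '' {j : Fin z | τ j ∈ A}))
    -- the MMSP `((G′,G″), τ)` rejects `𝔅`:
    (hreject : ∀ B ∈ 𝔅,
      Submodule.span F
          (Set.range fun i : Fin x =>
            (Pi.single (Fin.castAdd y i) 1 : Fin (x + y) → F))
        ⊓ Submodule.span F
          ((fun j => Fin.append (fun c => G' j c) (fun c => G'' j c)) '' {j : Fin z | τ j ∈ B})
        = ⊥) :
    -- (i) correctness: for every `A ∈ 𝔄` there is `K_A` with `K_A · D_{τ⁻¹(A)} = M_k`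
    -- for every `k`, `M`, `R`, `W`:
    (∀ A ∈ 𝔄, ∃ KA : Matrix (Fin x) {i // τ i ∈ A} F,
      ∀ (k : Fin f) (M : Fin f × Fin x → F)
        (R : Matrix (Fin y) (Fin f × Fin x) F) (W : Fin y → F),
        KA.mulVec
            (fun i => ((G' * Emat F f x k + G'' * R).mulVec M + G''.mulVec W) i.1)
          = fun i => M (k, i))
    ∧
    -- (ii) server secrecy: for every `𝒳 ⊆ [n]`, fixed `R = ρ`, `k`, and files `M`, `M̃`
    -- agreeing on the `k`-th block, the distribution of `D_{τ⁻¹(𝒳)}` over uniform `W`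
    -- is the same for `M` and `M̃`:
    (∀ (𝒳 : Finset (Fin n)) (ρ : Matrix (Fin y) (Fin f × Fin x) F) (k : Fin f)
        (M M' : Fin f × Fin x → F),
      (∀ i : Fin x, M (k, i) = M' (k, i)) →
      ∀ v : {i // τ i ∈ 𝒳} → F,
        Nat.card {W : Fin y → F //
          ∀ i : {i // τ i ∈ 𝒳},
            ((G' * Emat F f x k + G'' * ρ).mulVec M + G''.mulVec W) i.1 = v i}
        = Nat.card {W : Fin y → F //
          ∀ i : {i // τ i ∈ 𝒳},
            ((G' * Emat F f x k + G'' * ρ).mulVec M' + G''.mulVec W) i.1 = v i})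
    ∧
    -- (iii) user secrecy: for every `B ∈ 𝔅`, the distribution of `Q_{τ⁻¹(B)}` over uniform
    -- `R` is the same for all `k`:
    (∀ B ∈ 𝔅, ∀ (k k' : Fin f) (V : {i // τ i ∈ B} → (Fin f × Fin x → F)),
      Nat.card {R : Matrix (Fin y) (Fin f × Fin x) F //
        ∀ i : {i // τ i ∈ B},
          (fun pr => (G' * Emat F f x k + G'' * R) i.1 pr) = V i}
      = Nat.card {R : Matrix (Fin y) (Fin f × Fin x) F //
        ∀ i : {i // τ i ∈ B},
          (fun pr => (G' * Emat F f x k' + G'' * R) i.1 pr) = V i}) := by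
  refine ⟨fun A hA => ?_, fun 𝒳 ρ k M M' hM v => ?_, fun B hB k k' V => ?_⟩
  · choose c hc using fun i => (mem_span_append_rows_iff G' G'' (τ · ∈ A) _).1 (haccept A hA i)
    refine ⟨Matrix.of c, fun k M R W => ?_⟩
    have hK' : Matrix.of c * G'.submatrix (Subtype.val : {j // τ j ∈ A} → Fin z) id
        = 1 := by
      ext i l
      have h := congrFun (hc i) (Fin.castAdd y l)
      rw [Fin.append_left] at h
      refine h.trans ?_
      simp [Matrix.one_apply, Pi.single_apply, eq_comm]
    have hK'' : Matrix.of c * G''.submatrix (Subtype.val : {j // τ j ∈ A} → Fin z) id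
        = 0 := by
      ext i l
      have h := congrFun (hc i) (Fin.natAdd x l)
      have hne : Fin.natAdd x l ≠ Fin.castAdd y i := by
        simp only [ne_eq, Fin.ext_iff, Fin.val_natAdd, Fin.val_castAdd]
        omega
      rw [Fin.append_right, Pi.single_eq_of_ne hne] at h
      exact h
    rw [answer_eq]
    change (Matrix.of c).mulVec ((G'.submatrix Subtype.val id).mulVec _ +
      (G''.submatrix Subtype.val id).mulVec _) = _
    rw [Matrix.mulVec_add, Matrix.mulVec_mulVec, Matrix.mulVec_mulVec, hK', hK'',
      Matrix.one_mulVec, Matrix.zero_mulVec, add_zero]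
  · refine Nat.card_congr (Equiv.subtypeEquiv
      (Equiv.addRight (ρ.mulVec M - ρ.mulVec M')) fun W => ?_)
    have hW : ρ.mulVec M' + (W + (ρ.mulVec M - ρ.mulVec M')) = ρ.mulVec M + W := by abel
    simp only [answer_eq, Equiv.coe_addRight, hW, hM]
  · obtain ⟨X, hX⟩ := Matrix.exists_eq_mul_of_vecMul_eq_zero
      (G'.submatrix (Subtype.val : {j // τ j ∈ B} → Fin z) id)
      (G''.submatrix Subtype.val id) fun c hc => by
        have hmem := (Submodule.eq_bot_iff _).1 (hreject B hB) _
          ⟨append_zero_mem_span_single _,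
            (mem_span_append_rows_iff G' G'' (τ · ∈ B) _).2 ⟨c, by rw [hc]⟩⟩
        ext l
        simpa using congrFun hmem (Fin.castAdd y l)
    refine Nat.card_congr (Equiv.subtypeEquiv
      (Equiv.addRight (X * Emat F f x k - X * Emat F f x k')) fun R => forall_congr' fun i => ?_)
    have hQ : G'.submatrix (Subtype.val : {j // τ j ∈ B} → Fin z) id * Emat F f x k
          + G''.submatrix Subtype.val id * R
        = G'.submatrix Subtype.val id * Emat F f x k'
          + G''.submatrix Subtype.val id * (R + (X * Emat F f x k - X * Emat F f x k')) := by
      rw [hX, Matrix.mul_assoc, Matrix.mul_assoc, Matrix.mul_add, Matrix.mul_sub]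
      abel
    exact Eq.congr_left (congrFun hQ i)
end

section
/- Let A, B, C be random variables on finite sets 𝒜, ℬ, 𝒞 with A and B independent, and let 1/2 ≤ α ≤ 1 and β ≥ 0. Suppose: (i) I(A;C) ≤ β; (ii) there is a map φ:𝒞→ℬ with Pr[φ(C)=B] ≥ α; and (iii) the guessing probability of B from (A,C) satisfies E[max_{b∈ℬ} Pr(B=b | A, C)] ≤ α. Then I(A; (B,C)) ≤ β + h₂(1−α) + (1−α)·log|ℬ| + log α, where h₂(p) = −p·log p − (1−p)·log(1−p) and logarithms are natural. -/
open scoped Classical BigOperators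

theorem sum_distOf_mul {Ω α : Type*} [Fintype Ω] [Fintype α] (p : Ω → ℝ) (X : Ω → α)
    (f : α → ℝ) : ∑ a, distOf p X a * f a = ∑ ω, p ω * f (X ω) := by
  simp only [distOf, Finset.sum_mul, ite_mul, zero_mul]
  rw [Finset.sum_comm]
  simp

theorem entropy_eq_sum {Ω α : Type*} [Fintype Ω] [Fintype α] (p : Ω → ℝ) (X : Ω → α) :
    entropy p X = -∑ ω, p ω * Real.log (distOf p X (X ω)) := by
  rw [entropy, sum_distOf_mul p X (fun a => Real.log (distOf p X a))]

theorem distOf_nonneg {Ω α : Type*} [Fintype Ω] {p : Ω → ℝ} (hp : ∀ ω, 0 ≤ p ω)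
    (X : Ω → α) (a : α) : 0 ≤ distOf p X a :=
  Finset.sum_nonneg fun ω _ => by split_ifs <;> simp [hp]

theorem distOf_self_pos {Ω α : Type*} [Fintype Ω] {p : Ω → ℝ} (hp : ∀ ω, 0 ≤ p ω)
    (X : Ω → α) {ω : Ω} (hω : 0 < p ω) : 0 < distOf p X (X ω) := by
  refine Finset.sum_pos' (fun i _ => by split_ifs <;> simp [hp]) ⟨ω, Finset.mem_univ _, ?_⟩
  simpa using hω

theorem sum_distOf_fst {Ω β γ : Type*} [Fintype Ω] [Fintype β] (p : Ω → ℝ)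
    (B : Ω → β) (C : Ω → γ) (c : γ) :
    ∑ b, distOf p (fun ω => (B ω, C ω)) (b, c) = distOf p C c := by
  simp only [distOf]
  rw [Finset.sum_comm]
  refine Finset.sum_congr rfl fun ω _ => ?_
  by_cases h : C ω = c <;> simp [h]

theorem sum_distOf_mid {Ω α β γ : Type*} [Fintype Ω] [Fintype β] (p : Ω → ℝ)
    (A : Ω → α) (B : Ω → β) (C : Ω → γ) (a : α) (c : γ) :
    ∑ b, distOf p (fun ω => (A ω, B ω, C ω)) (a, b, c)
      = distOf p (fun ω => (A ω, C ω)) (a, c) := by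
  simp only [distOf]
  rw [Finset.sum_comm]
  refine Finset.sum_congr rfl fun ω _ => ?_
  by_cases h : C ω = c <;> by_cases h' : A ω = a <;> simp [h, h']

/-- The conditional entropy `H(B ∣ A, C)` is at least `-log α` when the guessing probability of
`B` from `(A, C)` is at most `α`. -/
theorem sum_log_sub_log_le_log_of_guess {Ω 𝒜 ℬ 𝒞 : Type*} [Fintype Ω] [Fintype 𝒜] [Fintype ℬ]
    [Fintype 𝒞] {p : Ω → ℝ} (hp : IsPMF p) (A : Ω → 𝒜) (B : Ω → ℬ) (C : Ω → 𝒞)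
    {α : ℝ} (hα : 0 < α)
    (hguess : (∑ a : 𝒜, ∑ c : 𝒞,
        ⨆ b : ℬ, distOf p (fun ω => (A ω, B ω, C ω)) (a, b, c)) ≤ α) :
    ∑ ω, p ω * (Real.log (distOf p (fun ω => (A ω, B ω, C ω)) (A ω, B ω, C ω))
      - Real.log (distOf p (fun ω => (A ω, C ω)) (A ω, C ω))) ≤ Real.log α := by
  set q := distOf p (fun ω => (A ω, B ω, C ω)) with hq
  set r := distOf p (fun ω => (A ω, C ω))
  have hq0 : ∀ x, 0 ≤ q x := distOf_nonneg hp.1 _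
  have hr0 : ∀ x, 0 ≤ r x := distOf_nonneg hp.1 _
  have hpt : ∀ ω, p ω * (Real.log (q (A ω, B ω, C ω)) - Real.log (r (A ω, C ω)))
      ≤ p ω * (q (A ω, B ω, C ω) / r (A ω, C ω)) * α⁻¹ + p ω * (Real.log α - 1) := by
    intro ω
    rcases (hp.1 ω).eq_or_lt with h | h
    · simp [← h]
    have h1 : 0 < q (A ω, B ω, C ω) := distOf_self_pos hp.1 (fun ω => (A ω, B ω, C ω)) h
    have h2 : 0 < r (A ω, C ω) := distOf_self_pos hp.1 (fun ω => (A ω, C ω)) h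
    have h3 := Real.log_le_sub_one_of_pos
      (show 0 < q (A ω, B ω, C ω) / r (A ω, C ω) * α⁻¹ by positivity)
    rw [Real.log_mul (by positivity) (by positivity), Real.log_div h1.ne' h2.ne',
      Real.log_inv] at h3
    have := mul_le_mul_of_nonneg_left h3 h.le
    linarith
  have hsum : ∑ ω, p ω * (q (A ω, B ω, C ω) / r (A ω, C ω)) ≤ α := by
    rw [← sum_distOf_mul p (fun ω => (A ω, B ω, C ω)) (fun x => q x / r (x.1, x.2.2)), ← hq]
    refine le_trans ?_ hguess
    rw [Fintype.sum_prod_type]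
    refine Finset.sum_le_sum fun a _ => ?_
    rw [Fintype.sum_prod_type_right]
    refine Finset.sum_le_sum fun c _ => ?_
    have hsup : ∀ b, q (a, b, c) ≤ ⨆ b, q (a, b, c) := fun b =>
      le_ciSup (f := fun b => q (a, b, c)) (Set.finite_range _).bddAbove b
    have hsup0 : 0 ≤ ⨆ b, q (a, b, c) := Real.iSup_nonneg fun b => hq0 _
    calc ∑ b, q (a, b, c) * (q (a, b, c) / r (a, c))
        ≤ ∑ b, q (a, b, c) * ((⨆ b, q (a, b, c)) / r (a, c)) := by
          refine Finset.sum_le_sum fun b _ => mul_le_mul_of_nonneg_left ?_ (hq0 _)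
          exact div_le_div_of_nonneg_right (hsup b) (hr0 _)
      _ = r (a, c) * ((⨆ b, q (a, b, c)) / r (a, c)) := by
          rw [← Finset.sum_mul, sum_distOf_mid]
      _ ≤ ⨆ b, q (a, b, c) := by
          rcases (hr0 (a, c)).eq_or_lt with h | h
          · simpa [← h] using hsup0
          · exact (mul_div_cancel₀ _ h.ne').le
  calc _ ≤ _ := Finset.sum_le_sum fun ω _ => hpt ω
    _ = (∑ ω, p ω * (q (A ω, B ω, C ω) / r (A ω, C ω))) * α⁻¹ + (Real.log α - 1) := by
        rw [Finset.sum_add_distrib, ← Finset.sum_mul, ← Finset.sum_mul, hp.2, one_mul]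
    _ ≤ α * α⁻¹ + (Real.log α - 1) := by gcongr
    _ = Real.log α := by rw [mul_inv_cancel₀ hα.ne']; ring

/-- The conditional entropy `H(B ∣ C)` is at most the cross entropy relative to any
sub-probability kernel `r` that is positive where the joint distribution is. -/
theorem sum_log_sub_log_le_cross {Ω ℬ 𝒞 : Type*} [Fintype Ω] [Fintype ℬ]
    [Fintype 𝒞] {p : Ω → ℝ} (hp : IsPMF p) (B : Ω → ℬ) (C : Ω → 𝒞) (r : ℬ → 𝒞 → ℝ)
    (hr0 : ∀ b c, 0 ≤ r b c) (hr1 : ∀ c, ∑ b, r b c ≤ 1)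
    (hpos : ∀ ω, 0 < p ω → 0 < r (B ω) (C ω)) :
    ∑ ω, p ω * (Real.log (distOf p C (C ω))
      - Real.log (distOf p (fun ω => (B ω, C ω)) (B ω, C ω)))
      ≤ -∑ ω, p ω * Real.log (r (B ω) (C ω)) := by
  set q := distOf p (fun ω => (B ω, C ω)) with hq
  set s := distOf p C
  have hq0 : ∀ x, 0 ≤ q x := distOf_nonneg hp.1 _
  have hs0 : ∀ x, 0 ≤ s x := distOf_nonneg hp.1 _
  have hpt : ∀ ω, p ω * (Real.log (s (C ω)) - Real.log (q (B ω, C ω)))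
      ≤ p ω * (s (C ω) * r (B ω) (C ω) / q (B ω, C ω))
        - (p ω + p ω * Real.log (r (B ω) (C ω))) := by
    intro ω
    rcases (hp.1 ω).eq_or_lt with h | h
    · simp [← h]
    have h1 : 0 < q (B ω, C ω) := distOf_self_pos hp.1 (fun ω => (B ω, C ω)) h
    have h2 : 0 < s (C ω) := distOf_self_pos hp.1 C h
    have h4 := hpos ω h
    have h3 := Real.log_le_sub_one_of_pos
      (show 0 < s (C ω) * r (B ω) (C ω) / q (B ω, C ω) by positivity)
    rw [Real.log_div (by positivity) h1.ne', Real.log_mul h2.ne' h4.ne'] at h3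
    have := mul_le_mul_of_nonneg_left h3 h.le
    linarith
  have hsum : ∑ ω, p ω * (s (C ω) * r (B ω) (C ω) / q (B ω, C ω)) ≤ 1 := by
    rw [← sum_distOf_mul p (fun ω => (B ω, C ω)) (fun x => s x.2 * r x.1 x.2 / q x), ← hq,
      Fintype.sum_prod_type_right]
    have hs1 : ∑ c, s c = 1 := by
      simpa [hp.2] using sum_distOf_mul p C (fun _ => 1)
    rw [← hs1]
    refine Finset.sum_le_sum fun c _ => ?_
    calc ∑ b, q (b, c) * (s c * r b c / q (b, c)) ≤ ∑ b, s c * r b c := by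
          refine Finset.sum_le_sum fun b _ => ?_
          rcases (hq0 (b, c)).eq_or_lt with h | h
          · simpa [← h] using mul_nonneg (hs0 c) (hr0 b c)
          · exact (mul_div_cancel₀ _ h.ne').le
      _ = s c * ∑ b, r b c := by rw [Finset.mul_sum]
      _ ≤ s c := mul_le_of_le_one_right (hs0 c) (hr1 c)
  calc _ ≤ _ := Finset.sum_le_sum fun ω _ => hpt ω
    _ = ∑ ω, p ω * (s (C ω) * r (B ω) (C ω) / q (B ω, C ω))
          - (1 + ∑ ω, p ω * Real.log (r (B ω) (C ω))) := by
        rw [Finset.sum_sub_distrib, Finset.sum_add_distrib, hp.2]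
    _ ≤ _ := by linarith

/-- Fano's inequality for `H(B ∣ C)`, when `φ(C)` recovers `B` with probability at least
`α ≥ 1 / 2`. -/
theorem fano_inequality {Ω ℬ 𝒞 : Type*} [Fintype Ω] [Fintype ℬ]
    [Fintype 𝒞] {p : Ω → ℝ} (hp : IsPMF p) (B : Ω → ℬ) (C : Ω → 𝒞) {α : ℝ}
    (hα1 : 1 / 2 ≤ α) (hα2 : α ≤ 1) (φ : 𝒞 → ℬ)
    (hφ : α ≤ prEvent p (fun ω => φ (C ω) = B ω)) :
    ∑ ω, p ω * (Real.log (distOf p C (C ω))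
      - Real.log (distOf p (fun ω => (B ω, C ω)) (B ω, C ω)))
      ≤ binEnt (1 - α) + (1 - α) * Real.log (Fintype.card ℬ) := by
  have hn : (1 : ℝ) ≤ Fintype.card ℬ := by
    have hne : Nonempty Ω := by
      by_contra h
      rw [not_nonempty_iff] at h
      simpa using hp.2
    have : Nonempty ℬ := hne.map B
    exact_mod_cast Fintype.card_pos (α := ℬ)
  set n : ℝ := (Fintype.card ℬ : ℝ)
  have hα0 : 0 < α := by linarith
  set t := (1 - α) / n
  have hnt : n * t = 1 - α := mul_div_cancel₀ _ (by positivity)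
  have ht0 : 0 ≤ t := div_nonneg (by linarith) (by linarith)
  have hp1 : prEvent p (fun ω => φ (C ω) = B ω) + ∑ ω, (if φ (C ω) = B ω then 0 else p ω) = 1 := by
    rw [prEvent, ← Finset.sum_add_distrib, ← hp.2]
    exact Finset.sum_congr rfl fun ω _ => by split_ifs <;> simp
  have hcross := sum_log_sub_log_le_cross hp B C (fun b c => if φ c = b then α else t)
    (fun b c => by split_ifs <;> linarith)
    (fun c => by
      calc ∑ b, (if φ c = b then α else t) ≤ ∑ b, ((if φ c = b then α else 0) + t) := by
            refine Finset.sum_le_sum fun b _ => ?_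
            split_ifs <;> linarith
        _ = 1 := by
            rw [Finset.sum_add_distrib]
            simp only [Finset.sum_ite_eq, Finset.mem_univ, if_true, Finset.sum_const,
              Finset.card_univ, nsmul_eq_mul]
            linarith)
    (fun ω hω => by
      split_ifs with h
      · exact hα0
      · refine div_pos ?_ (by linarith)
        have h1 : p ω ≤ ∑ ω, (if φ (C ω) = B ω then 0 else p ω) := by
          refine le_trans ?_ (Finset.single_le_sum
            (f := fun ω => if φ (C ω) = B ω then 0 else p ω)
            (fun i _ => by split_ifs <;> simp [hp.1]) (Finset.mem_univ ω))
          simp [h]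
        linarith)
  refine hcross.trans ?_
  set S := prEvent p (fun ω => φ (C ω) = B ω) with hS
  have hsplit : ∑ ω, p ω * Real.log (if φ (C ω) = B ω then α else t)
      = S * Real.log α + (1 - S) * Real.log t := by
    rw [show 1 - S = ∑ ω, (if φ (C ω) = B ω then 0 else p ω) by linarith, hS, prEvent,
      Finset.sum_mul, Finset.sum_mul, ← Finset.sum_add_distrib]
    exact Finset.sum_congr rfl fun ω _ => by split_ifs <;> simp
  have hS1 : S ≤ 1 := by
    have : 0 ≤ ∑ ω, (if φ (C ω) = B ω then 0 else p ω) :=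
      Finset.sum_nonneg fun ω _ => by split_ifs <;> simp [hp.1]
    linarith
  simp only [hsplit, binEnt, sub_sub_cancel]
  rcases hα2.eq_or_lt with h | h
  · subst h
    simp [le_antisymm hS1 hφ]
  · have htpos : 0 < t := div_pos (by linarith) (by linarith)
    have hlog : Real.log t = Real.log (1 - α) - Real.log n :=
      Real.log_div (by linarith) (by linarith)
    have htα : Real.log t ≤ Real.log α := Real.log_le_log htpos (by nlinarith)
    have := mul_nonneg (sub_nonneg.2 hφ) (sub_nonneg.2 htα)
    have h2 : (1 - α) * Real.log t = (1 - α) * (Real.log (1 - α) - Real.log n) := by rw [hlog]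
    linarith

/-!
STATEMENT 16: If `A` and `B` are independent, `I(A;C) ≤ β`, some map `φ` recovers `B` from
`C` with probability at least `α`, and the guessing probability of `B` from `(A,C)`,
`E[max_b Pr(B = b | A, C)] = Σ_{a,c} max_b Pr(A = a, B = b, C = c)`, is at most `α`
(with `1/2 ≤ α ≤ 1`, `β ≥ 0`), then
`I(A;(B,C)) ≤ β + h₂(1−α) + (1−α)·log|ℬ| + log α`.
-/

theorem spir_joint_information_bound
    (Ω 𝒜 ℬ 𝒞 : Type*) [Fintype Ω] [Fintype 𝒜] [Fintype ℬ] [Fintype 𝒞]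
    (p : Ω → ℝ) (hp : IsPMF p)
    (A : Ω → 𝒜) (B : Ω → ℬ) (C : Ω → 𝒞)
    (α β : ℝ) (hα1 : 1 / 2 ≤ α) (hα2 : α ≤ 1) (hβ : 0 ≤ β)
    -- `A` and `B` are independent:
    (hindep : IndepRV p A B)
    -- (i) `I(A;C) ≤ β`:
    (hMI : mutualInfo p A C ≤ β)
    -- (ii) `B` is recovered from `C` with probability at least `α`:
    (hrec : ∃ φ : 𝒞 → ℬ, α ≤ prEvent p (fun ω => φ (C ω) = B ω))
    -- (iii) the guessing probability of `B` from `(A,C)` is at most `α`: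
    (hguess : (∑ a : 𝒜, ∑ c : 𝒞,
        ⨆ b : ℬ, distOf p (fun ω => (A ω, B ω, C ω)) (a, b, c)) ≤ α) :
    mutualInfo p A (fun ω => (B ω, C ω))
      ≤ β + binEnt (1 - α) + (1 - α) * Real.log (Fintype.card ℬ) + Real.log α := by
  obtain ⟨φ, hφ⟩ := hrec
  have h1 := fano_inequality hp B C hα1 hα2 φ hφ
  have h2 := sum_log_sub_log_le_log_of_guess hp A B C (by linarith) hguess
  simp only [mul_sub, Finset.sum_sub_distrib] at h1 h2
  simp only [mutualInfo, entropy_eq_sum] at hMI ⊢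
  linarith
end
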